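/- Let n ≥ 1 and let x, y, u_1, u_2, u_3, u_4, α be elements of a commutative ring satisfying x + y = u_3 + u_4 and x·y = u_1·u_2. Then ∑_{σ∈PRW_{n+1}} x^{des(σ)} y^{asc(σ)} α^{LRmin(σ)+RLmin(σ)−2} = ∑_{σ∈PRW_{n+1}} (u_1 u_2)^{M(σ)} u_3^{da(σ)} u_4^{dd(σ)} α^{LRmin(σ)+RLmin(σ)−2}. -/

import Mathlib

/-- The letter at (1-based) position `i` of the word `w`, with the boundary
convention that positions `0` and `> w.length` carry the value `w.length + 1`
(playing the role of `+∞` for a permutation word of `{1,…,n}`). -/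
def wB (w : List ℕ) (i : ℕ) : ℕ :=
  if 1 ≤ i ∧ i ≤ w.length then w.getD (i - 1) 0 else w.length + 1

/-- The one-line word `σ_1 ⋯ σ_n` (with letters in `{1,…,n}`) of a permutation of `Fin n`. -/
def word {n : ℕ} (σ : Equiv.Perm (Fin n)) : List ℕ := List.ofFn (fun i => (σ i : ℕ) + 1)

/-- Number of descents: indices `i ∈ {1,…,n-1}` with `σ_i > σ_{i+1}`. -/
def desW (w : List ℕ) : ℕ :=
  ((Finset.Icc 1 (w.length - 1)).filter (fun i => wB w (i + 1) < wB w i)).card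

/-- Number of ascents: indices `i ∈ {1,…,n-1}` with `σ_i < σ_{i+1}`. -/
def ascW (w : List ℕ) : ℕ :=
  ((Finset.Icc 1 (w.length - 1)).filter (fun i => wB w i < wB w (i + 1))).card

/-- Position `i` is a double ascent: `σ_{i-1} < σ_i < σ_{i+1}` (boundary `σ_0 = σ_{n+1} = +∞`). -/
abbrev isDAat (w : List ℕ) (i : ℕ) : Prop := wB w (i - 1) < wB w i ∧ wB w i < wB w (i + 1)

/-- Position `i` is a double descent: `σ_{i-1} > σ_i > σ_{i+1}`. -/
abbrev isDDat (w : List ℕ) (i : ℕ) : Prop := wB w i < wB w (i - 1) ∧ wB w (i + 1) < wB w i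

/-- Position `i` is a peak: `σ_{i-1} < σ_i > σ_{i+1}`. -/
abbrev isPkat (w : List ℕ) (i : ℕ) : Prop := wB w (i - 1) < wB w i ∧ wB w (i + 1) < wB w i

/-- Position `i` is a valley: `σ_{i-1} > σ_i < σ_{i+1}`. -/
abbrev isVlat (w : List ℕ) (i : ℕ) : Prop := wB w i < wB w (i - 1) ∧ wB w i < wB w (i + 1)

/-- Position `i` holds a left-to-right minimum: `σ_j > σ_i` for all `j < i`. -/
abbrev isLRat (w : List ℕ) (i : ℕ) : Prop := ∀ j ∈ Finset.Icc 1 (i - 1), wB w i < wB w j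

/-- Position `i` holds a right-to-left minimum: `σ_j > σ_i` for all `j > i`. -/
abbrev isRLat (w : List ℕ) (i : ℕ) : Prop := ∀ j ∈ Finset.Icc (i + 1) w.length, wB w i < wB w j

/-- `da`, the number of double ascents. -/
def daW (w : List ℕ) : ℕ := ((Finset.Icc 1 w.length).filter (isDAat w)).card

/-- `dd`, the number of double descents. -/
def ddW (w : List ℕ) : ℕ := ((Finset.Icc 1 w.length).filter (isDDat w)).card

/-- `M`, the number of peaks. -/
def pkW (w : List ℕ) : ℕ := ((Finset.Icc 1 w.length).filter (isPkat w)).card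

/-- `LRmin`, the number of left-to-right minima. -/
def lrminW (w : List ℕ) : ℕ := ((Finset.Icc 1 w.length).filter (isLRat w)).card

/-- `RLmin`, the number of right-to-left minima. -/
def rlminW (w : List ℕ) : ℕ := ((Finset.Icc 1 w.length).filter (isRLat w)).card

/-- The word belongs to `PRW`: if it has an ascent, the first ascent occurs at the letter `1`. -/
abbrev isPRW (w : List ℕ) : Prop :=
  ∀ i ∈ Finset.Icc 1 (w.length - 1), wB w i < wB w (i + 1) →
    (∀ j ∈ Finset.Icc 1 (i - 1), ¬ wB w j < wB w (j + 1)) → wB w i = 1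

/-- The set `PRW_n` of permutations whose first ascent (if any) appears at the letter `1`. -/
def PRW (n : ℕ) : Finset (Equiv.Perm (Fin n)) :=
  Finset.univ.filter (fun σ => isPRW (word σ))

/-- The words using every letter of `S` exactly once. -/
abbrev arrangements (S : Finset ℕ) : Finset (List ℕ) := S.val.lists.toFinset

theorem mem_arrangements {S : Finset ℕ} {l : List ℕ} :
    l ∈ arrangements S ↔ l.Nodup ∧ l.toFinset = S := by
  rw [arrangements, Multiset.mem_toFinset, Multiset.mem_lists_iff]
  constructor
  · intro h
    have hn : l.Nodup := by
      rw [← Multiset.coe_nodup]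
      have := S.nodup
      rw [h] at this
      exact this
    refine ⟨hn, ?_⟩
    ext x
    rw [List.mem_toFinset, ← Finset.mem_val, h]
    rfl
  · rintro ⟨hn, rfl⟩
    simp [List.toFinset_val, hn.dedup]

theorem append_cons_mem_arrangements {S A : Finset ℕ} {m : ℕ} (hm : m ∉ S) (hA : A ⊆ S)
    {v w : List ℕ} (hv : v ∈ arrangements A) (hw : w ∈ arrangements (S \ A)) :
    v ++ m :: w ∈ arrangements (insert m S) := by
  rw [mem_arrangements] at hv hw ⊢
  obtain ⟨hv, rfl⟩ := hv
  obtain ⟨hw, hw'⟩ := hw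
  constructor
  · rw [List.nodup_append, List.nodup_cons]
    refine ⟨hv, ⟨?_, hw⟩, ?_⟩
    · intro h
      rw [← List.mem_toFinset, hw'] at h
      exact hm (Finset.mem_sdiff.1 h).1
    · intro x hx y hy
      rintro rfl
      rcases List.mem_cons.1 hy with rfl | hy
      · exact hm (hA (List.mem_toFinset.2 hx))
      · rw [← List.mem_toFinset, hw'] at hy
        exact (Finset.mem_sdiff.1 hy).2 (List.mem_toFinset.2 hx)
  · rw [List.toFinset_append, List.toFinset_cons, hw', Finset.union_insert,
      Finset.union_sdiff_of_subset hA]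

theorem sum_arrangements_insert {M : Type*} [AddCommMonoid M] {S : Finset ℕ} {m : ℕ}
    (hm : m ∉ S) (f : List ℕ → M) :
    ∑ l ∈ arrangements (insert m S), f l =
      ∑ A ∈ S.powerset, ∑ v ∈ arrangements A, ∑ w ∈ arrangements (S \ A), f (v ++ m :: w) := by
  simp_rw [← Finset.sum_product']
  rw [Finset.sum_sigma']
  symm
  refine Finset.sum_bij (fun z _ => z.2.1 ++ m :: z.2.2) ?_ ?_ ?_ ?_
  · rintro ⟨A, v, w⟩ h
    simp only [Finset.mem_sigma, Finset.mem_powerset, Finset.mem_product] at h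
    exact append_cons_mem_arrangements hm h.1 h.2.1 h.2.2
  · rintro ⟨A, v, w⟩ h ⟨A', v', w'⟩ h' e
    simp only [Finset.mem_sigma, Finset.mem_powerset, Finset.mem_product, mem_arrangements] at h h' e
    obtain ⟨hA, ⟨hv, rfl⟩, hw, hw'⟩ := h
    obtain ⟨hA', ⟨hv', rfl⟩, hw2, hw2'⟩ := h'
    have h1 : m ∉ v := fun h => hm (hA (List.mem_toFinset.2 h))
    have h2 : m ∉ v' := fun h => hm (hA' (List.mem_toFinset.2 h))
    have h3 : m ∉ w := fun h => hm (by
      have := List.mem_toFinset.2 h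
      rw [hw'] at this
      exact (Finset.mem_sdiff.1 this).1)
    obtain ⟨rfl, e2⟩ : v = v' ∧ w = w' := by
      rw [List.append_eq_append_iff] at e
      rcases e with ⟨t, rfl, ht⟩ | ⟨t, rfl, ht⟩ <;> cases t <;> simp_all
    simp [e2]
  · intro l hl
    rw [mem_arrangements] at hl
    obtain ⟨hn, hl⟩ := hl
    have hml : m ∈ l := by rw [← List.mem_toFinset, hl]; simp
    obtain ⟨v, w, rfl⟩ := List.append_of_mem hml
    rw [List.nodup_append, List.nodup_cons] at hn
    obtain ⟨hv, ⟨hmw, hw⟩, hd⟩ := hn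
    rw [List.toFinset_append, List.toFinset_cons] at hl
    have hmv : m ∉ v := fun h => hd m h m (by simp) rfl
    have key : ∀ x, x ∈ S ↔ x ∈ v ∨ x ∈ w := by
      intro x
      have := Finset.ext_iff.1 hl x
      simp only [Finset.mem_union, Finset.mem_insert, List.mem_toFinset] at this
      by_cases hx : x = m
      · subst hx; simp [hm, hmv, hmw]
      · simp [hx] at this; exact this.symm
    refine ⟨⟨v.toFinset, v, w⟩, ?_, rfl⟩
    simp only [Finset.mem_sigma, Finset.mem_powerset, Finset.mem_product, mem_arrangements]
    refine ⟨fun x hx => (key x).2 (Or.inl (List.mem_toFinset.1 hx)), ⟨hv, trivial⟩, hw, ?_⟩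
    ext x
    rw [Finset.mem_sdiff, key x]
    simp only [List.mem_toFinset]
    constructor
    · intro h
      exact ⟨Or.inr h, fun h' => hd x h' x (List.mem_cons_of_mem _ h) rfl⟩
    · rintro ⟨h | h, h'⟩
      · exact absurd h h'
      · exact h
  · intros; rfl

/-- The weight of a letter `x` with neighbours `l` and `r`: `c` for a peak, `a` for a double
ascent, `b` for a double descent, and `1` otherwise. -/
def letterWeight {R : Type*} [CommRing R] (c a b : R) (l x r : ℕ) : R :=
  (if l < x ∧ r < x then c else 1) * (if l < x ∧ x < r then a else 1) *
    (if x < l ∧ r < x then b else 1)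

/-- The product of the letter weights of a word placed between the letters `p` and `q`. -/
def wordWeight {R : Type*} [CommRing R] (c a b : R) : ℕ → List ℕ → ℕ → R
  | _, [], _ => 1
  | p, x :: l, q => letterWeight c a b p x (l.headD q) * wordWeight c a b x l q

/-- The number of right-to-left minima of a word, computed recursively. -/
def countRLMin : List ℕ → ℕ
  | [] => 0
  | x :: l => (if ∀ y ∈ l, x < y then 1 else 0) + countRLMin l

theorem countRLMin_append_cons {v w : List ℕ} {m : ℕ} (hv : ∀ y ∈ v, m < y)
    (hw : ∀ y ∈ w, m < y) : countRLMin (v ++ m :: w) = 1 + countRLMin w := by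
  induction v with
  | nil => simp only [List.nil_append, countRLMin, if_pos hw]
  | cons x v ih =>
    have hx := hv x (by simp)
    rw [List.cons_append, countRLMin, ih (fun y hy => hv y (by simp [hy])), if_neg, zero_add]
    intro h
    exact absurd (h m (by simp)) (by omega)

section Weights

variable {R : Type*} [CommRing R] (c a b : R)

theorem letterWeight_peak {l x r : ℕ} (hl : l < x) (hr : r < x) :
    letterWeight c a b l x r = c := by
  simp [letterWeight, hl, hr, hl.not_gt, hr.not_gt]

theorem letterWeight_doubleAscent {l x r : ℕ} (hl : l < x) (hr : x < r) :
    letterWeight c a b l x r = a := by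
  simp [letterWeight, hl, hr, hl.not_gt, hr.not_gt]

theorem letterWeight_doubleDescent {l x r : ℕ} (hl : x < l) (hr : r < x) :
    letterWeight c a b l x r = b := by
  simp [letterWeight, hl, hr, hl.not_gt, hr.not_gt]

theorem letterWeight_valley {l x r : ℕ} (hl : x < l) (hr : x < r) :
    letterWeight c a b l x r = 1 := by
  simp [letterWeight, hl.not_gt, hr.not_gt]

theorem wordWeight_append_cons (p : ℕ) (v : List ℕ) (m : ℕ) (w : List ℕ) (q : ℕ) :
    wordWeight c a b p (v ++ m :: w) q =
      wordWeight c a b p v m * letterWeight c a b (v.getLastD p) m (w.headD q) *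
        wordWeight c a b m w q := by
  induction v generalizing p with
  | nil => simp [wordWeight]
  | cons x v ih =>
    have : (v ++ m :: w).headD q = v.headD m := by cases v <;> rfl
    rw [List.cons_append, wordWeight, ih, wordWeight, List.getLastD_cons, this]
    ring

theorem lt_headD {w : List ℕ} {m q : ℕ} (hw : ∀ y ∈ w, m < y) (h : w = [] → m < q) :
    m < w.headD q := by
  cases w with
  | nil => exact h rfl
  | cons x w => exact hw x (by simp)

theorem lt_getLastD {w : List ℕ} {m q : ℕ} (hw : ∀ y ∈ w, m < y) (h : w = [] → m < q) :
    m < w.getLastD q := by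
  rcases List.eq_nil_or_concat w with rfl | ⟨v, x, rfl⟩
  · exact h rfl
  · simpa using hw x (by simp)

/-- The total weight of the arrangements of `S` placed between the letters `p` and `q`. -/
def arrangementSum (p q : ℕ) (S : Finset ℕ) : R :=
  ∑ l ∈ arrangements S, wordWeight c a b p l q

/-- The sum of `wordWeight * α ^ countRLMin` over the arrangements of `S`. -/
def rlMinSum (α : R) (p q : ℕ) (S : Finset ℕ) : R :=
  ∑ l ∈ arrangements S, wordWeight c a b p l q * α ^ countRLMin l

/-- The weight sum over pairs of a set `D` of letters preceding `z` and an arrangement of `S \ D`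
following `z`. -/
def prefixedSum (α : R) (z q : ℕ) (S : Finset ℕ) : R :=
  ∑ D ∈ S.powerset, (b * α) ^ D.card * rlMinSum c a b α z q (S \ D)

theorem arrangements_empty : arrangements ∅ = {[]} := by
  ext l
  rw [mem_arrangements]
  simp only [List.toFinset_eq_empty_iff, Finset.mem_singleton]
  constructor
  · exact fun h => h.2
  · rintro rfl; simp

theorem mem_of_arrangement {S : Finset ℕ} {l : List ℕ} (h : l ∈ arrangements S) {y : ℕ} :
    y ∈ l ↔ y ∈ S := by
  rw [← (mem_arrangements.1 h).2, List.mem_toFinset]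

theorem arrangement_eq_nil_iff {S : Finset ℕ} {l : List ℕ} (h : l ∈ arrangements S) :
    l = [] ↔ S = ∅ := by
  rw [← (mem_arrangements.1 h).2, List.toFinset_eq_empty_iff]

theorem arrangementSum_insert {S : Finset ℕ} {m p q : ℕ} (hm : ∀ y ∈ S, m < y) (hp : p < m)
    (hq : q < m) :
    arrangementSum c a b p q (insert m S) =
      ∑ A ∈ S.powerset, ((if A = ∅ then (if S \ A = ∅ then c else a) else
        (if S \ A = ∅ then b else 1)) * (arrangementSum c a b p m A *
          arrangementSum c a b m q (S \ A))) := by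
  have hmS : m ∉ S := fun h => lt_irrefl _ (hm m h)
  rw [arrangementSum, sum_arrangements_insert hmS]
  refine Finset.sum_congr rfl fun A hA => ?_
  rw [arrangementSum, arrangementSum, Finset.sum_mul_sum, Finset.mul_sum]
  refine Finset.sum_congr rfl fun v hv => ?_
  rw [Finset.mul_sum]
  refine Finset.sum_congr rfl fun w hw => ?_
  rw [Finset.mem_powerset] at hA
  have hv' : ∀ y ∈ v, m < y := fun y hy => hm y (hA ((mem_of_arrangement hv).1 hy))
  have hw' : ∀ y ∈ w, m < y := fun y hy =>
    hm y (Finset.mem_sdiff.1 ((mem_of_arrangement hw).1 hy)).1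
  rw [wordWeight_append_cons]
  suffices h : letterWeight c a b (v.getLastD p) m (w.headD q) =
      (if A = ∅ then (if S \ A = ∅ then c else a) else (if S \ A = ∅ then b else 1)) by
    rw [h]; ring
  simp only [← arrangement_eq_nil_iff hv, ← arrangement_eq_nil_iff hw]
  by_cases h1 : v = [] <;> by_cases h2 : w = []
  · subst h1 h2
    simpa using letterWeight_peak c a b hp hq
  · subst h1
    simpa only [h2, if_true, if_false, List.getLastD_nil] using
      letterWeight_doubleAscent c a b hp (lt_headD (q := q) hw' (by simp [h2]))
  · subst h2
    simpa only [h1, if_true, if_false, List.headD_nil] using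
      letterWeight_doubleDescent c a b (lt_getLastD (q := p) hv' (by simp [h1])) hq
  · simpa only [h1, h2, if_false] using letterWeight_valley c a b
      (lt_getLastD (q := p) hv' (by simp [h1])) (lt_headD (q := q) hw' (by simp [h2]))

theorem rlMinSum_insert (α : R) {S : Finset ℕ} {m p q : ℕ} (hm : ∀ y ∈ S, m < y) (hp : p < m)
    (hq : m < q) :
    rlMinSum c a b α p q (insert m S) =
      ∑ A ∈ S.powerset, ((if A = ∅ then a else 1) * α * (arrangementSum c a b p m A *
          rlMinSum c a b α m q (S \ A))) := by
  have hmS : m ∉ S := fun h => lt_irrefl _ (hm m h)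
  rw [rlMinSum, sum_arrangements_insert hmS]
  refine Finset.sum_congr rfl fun A hA => ?_
  rw [arrangementSum, rlMinSum, Finset.sum_mul_sum, Finset.mul_sum]
  refine Finset.sum_congr rfl fun v hv => ?_
  rw [Finset.mul_sum]
  refine Finset.sum_congr rfl fun w hw => ?_
  rw [Finset.mem_powerset] at hA
  have hv' : ∀ y ∈ v, m < y := fun y hy => hm y (hA ((mem_of_arrangement hv).1 hy))
  have hw' : ∀ y ∈ w, m < y := fun y hy =>
    hm y (Finset.mem_sdiff.1 ((mem_of_arrangement hw).1 hy)).1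
  rw [wordWeight_append_cons, countRLMin_append_cons hv' hw', pow_add, pow_one]
  suffices h : letterWeight c a b (v.getLastD p) m (w.headD q) = (if A = ∅ then a else 1) by
    rw [h]; ring
  have h4 := lt_headD (q := q) hw' (fun _ => hq)
  simp only [← arrangement_eq_nil_iff hv]
  by_cases h1 : v = []
  · subst h1
    simpa only [if_true, List.getLastD_nil] using letterWeight_doubleAscent c a b hp h4
  · simpa only [h1, if_false] using
      letterWeight_valley c a b (lt_getLastD (q := p) hv' (by simp [h1])) h4

theorem prefixedSum_insert (α : R) {S : Finset ℕ} {m z q : ℕ} (hm : ∀ y ∈ S, m < y)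
    (hz : z < m) (hq : m < q) :
    prefixedSum c a b α z q (insert m S) =
      b * α * prefixedSum c a b α z q S +
      ∑ A ∈ S.powerset, ((if A = ∅ then a else 1) * α * (arrangementSum c a b z m A *
          prefixedSum c a b α m q (S \ A))) := by
  have hmS : m ∉ S := fun h => lt_irrefl _ (hm m h)
  rw [prefixedSum, Finset.sum_powerset_insert hmS, add_comm]
  congr 1
  · rw [prefixedSum, Finset.mul_sum]
    refine Finset.sum_congr rfl fun D hD => ?_
    have hmD : m ∉ D := fun h => hmS (Finset.mem_powerset.1 hD h)
    rw [Finset.card_insert_of_notMem hmD, Finset.insert_sdiff_insert,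
      Finset.sdiff_insert_of_notMem hmS]
    ring
  · have h1 : ∀ D ∈ S.powerset, (b * α) ^ D.card * rlMinSum c a b α z q (insert m S \ D) =
        ∑ A ∈ (S \ D).powerset, (b * α) ^ D.card * ((if A = ∅ then a else 1) * α *
          (arrangementSum c a b z m A * rlMinSum c a b α m q ((S \ D) \ A))) := by
      intro D hD
      have hmD : m ∉ D := fun h => hmS (Finset.mem_powerset.1 hD h)
      rw [Finset.insert_sdiff_of_notMem _ hmD, rlMinSum_insert c a b α
        (fun y hy => hm y (Finset.mem_sdiff.1 hy).1) hz hq, Finset.mul_sum]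
    rw [Finset.sum_congr rfl h1]
    simp_rw [prefixedSum, Finset.mul_sum]
    rw [Finset.sum_comm' (t' := S.powerset) (s' := fun A => (S \ A).powerset)]
    · refine Finset.sum_congr rfl fun A _ => Finset.sum_congr rfl fun D _ => ?_
      rw [sdiff_right_comm]
      ring
    · intro D A
      simp only [Finset.mem_powerset, Finset.subset_sdiff]
      constructor
      · rintro ⟨h1, h2, h3⟩; exact ⟨⟨h1, h3.symm⟩, h2⟩
      · rintro ⟨⟨h1, h3⟩, h2⟩; exact ⟨h1, h2, h3.symm⟩

theorem arrangementSum_eq {a b a' b' : R} (h : a + b = a' + b') (S : Finset ℕ) :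
    ∀ p q p' q' : ℕ, (∀ y ∈ S, p < y ∧ q < y ∧ p' < y ∧ q' < y) →
      arrangementSum c a b p q S = arrangementSum c a' b' p' q' S := by
  induction S using Finset.strongInduction with
  | H S ih =>
  rcases S.eq_empty_or_nonempty with rfl | hS
  · intro p q p' q' _
    simp [arrangementSum, arrangements_empty, wordWeight]
  intro p q p' q' hb
  obtain ⟨m, T, rfl, hm⟩ : ∃ m T, S = insert m T ∧ ∀ y ∈ T, m < y :=
    ⟨S.min' hS, S.erase (S.min' hS), (Finset.insert_erase (S.min'_mem hS)).symm, fun y hy =>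
      S.min'_lt_of_mem_erase_min' hS hy⟩
  have hmT : m ∉ T := fun h => lt_irrefl _ (hm m h)
  obtain ⟨hp, hq, hp', hq'⟩ := hb m (by simp)
  have hss : ∀ A ⊆ T, A ⊂ insert m T := fun A hA => Finset.ssubset_of_subset_of_ssubset hA
    (Finset.ssubset_insert hmT)
  have IH : ∀ A ⊆ T, ∀ p q p' q' : ℕ, p ≤ m → q ≤ m → p' ≤ m → q' ≤ m →
      arrangementSum c a b p q A = arrangementSum c a' b' p' q' A := by
    intro A hA p q p' q' h1 h2 h3 h4
    refine ih A (hss A hA) p q p' q' fun y hy => ?_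
    have := hm y (hA hy)
    omega
  rw [arrangementSum_insert c a b hm hp hq, arrangementSum_insert c a' b' hm hp' hq']
  set X : Finset ℕ → R := fun A => arrangementSum c a' b' p' m A *
    arrangementSum c a' b' m q' (T \ A) with hX
  have e1 : ∀ A ∈ T.powerset, arrangementSum c a b p m A * arrangementSum c a b m q (T \ A)
      = X A := by
    intro A hA
    rw [IH A (Finset.mem_powerset.1 hA) p m p' m hp.le le_rfl hp'.le le_rfl,
      IH (T \ A) Finset.sdiff_subset m q m q' le_rfl hq.le le_rfl hq'.le]
  rw [Finset.sum_congr rfl fun A hA => by rw [e1 A hA]]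
  change _ = ∑ A ∈ T.powerset, _ * X A
  rcases T.eq_empty_or_nonempty with rfl | hT
  · simp [hX]
  have hX0 : X ∅ = X T := by
    have e0 : ∀ r s r' s' : ℕ, arrangementSum c a' b' r s ∅ = arrangementSum c a' b' r' s' ∅ := by
      intros; simp [arrangementSum, arrangements_empty, wordWeight]
    simp only [hX, Finset.sdiff_empty, Finset.sdiff_self]
    rw [← IH T subset_rfl m m m q' le_rfl le_rfl le_rfl hq'.le,
      ← IH T subset_rfl m m p' m le_rfl le_rfl hp'.le le_rfl, e0 p' m m q', mul_comm]
  rw [← sub_eq_zero, ← Finset.sum_sub_distrib]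
  rw [← Finset.add_sum_erase _ _ (Finset.empty_mem_powerset T), ← Finset.add_sum_erase _ _
    (show T ∈ T.powerset.erase ∅ by simp [hT.ne_empty]), Finset.sum_eq_zero]
  · simp only [if_true, Finset.sdiff_empty, hT.ne_empty, if_false, Finset.sdiff_self]
    change a * X ∅ - a' * X ∅ + (b * X T - b' * X T + 0) = 0
    rw [hX0]
    linear_combination X T * h
  · intro A hA
    simp only [Finset.mem_erase, Finset.mem_powerset] at hA
    have h1 : T \ A ≠ ∅ := fun h => hA.1 (Finset.Subset.antisymm hA.2.2
      (Finset.sdiff_eq_empty_iff_subset.1 h))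
    simp only [if_neg h1, if_neg hA.2.1]
    exact sub_self _

theorem prefixedSum_eq {a b a' b' : R} (h : a + b = a' + b') (α : R) (q : ℕ) (S : Finset ℕ) :
    ∀ z z' : ℕ, (∀ y ∈ S, z < y ∧ z' < y ∧ y < q) →
      prefixedSum c a b α z q S = prefixedSum c a' b' α z' q S := by
  induction S using Finset.strongInduction with
  | H S ih =>
  rcases S.eq_empty_or_nonempty with rfl | hS
  · intro z z' _
    simp [prefixedSum, rlMinSum, arrangements_empty, wordWeight]
  intro z z' hb
  obtain ⟨m, T, rfl, hm⟩ : ∃ m T, S = insert m T ∧ ∀ y ∈ T, m < y :=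
    ⟨S.min' hS, S.erase (S.min' hS), (Finset.insert_erase (S.min'_mem hS)).symm, fun y hy =>
      S.min'_lt_of_mem_erase_min' hS hy⟩
  have hmT : m ∉ T := fun h => lt_irrefl _ (hm m h)
  obtain ⟨hz, hz', hq⟩ := hb m (by simp)
  have IH : ∀ A ⊆ T, ∀ z z' : ℕ, z ≤ m → z' ≤ m →
      prefixedSum c a b α z q A = prefixedSum c a' b' α z' q A := by
    intro A hA z z' h1 h2
    refine ih A (Finset.ssubset_of_subset_of_ssubset hA (Finset.ssubset_insert hmT)) z z'
      fun y hy => ?_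
    have := hm y (hA hy)
    have := (hb y (by simp [hA hy])).2.2
    omega
  rw [prefixedSum_insert c a b α hm hz hq, prefixedSum_insert c a' b' α hm hz' hq]
  set X : Finset ℕ → R := fun A => arrangementSum c a' b' z' m A *
    prefixedSum c a' b' α m q (T \ A) with hX
  have e1 : ∀ A ∈ T.powerset, arrangementSum c a b z m A * prefixedSum c a b α m q (T \ A)
      = X A := by
    intro A hA
    rw [IH (T \ A) Finset.sdiff_subset m m le_rfl le_rfl,
      arrangementSum_eq c h A z m z' m fun y hy => ?_]
    have := hm y (Finset.mem_powerset.1 hA hy)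
    omega
  rw [Finset.sum_congr rfl fun A hA => by rw [e1 A hA]]
  rw [← Finset.add_sum_erase _ _ (Finset.empty_mem_powerset T), ← Finset.add_sum_erase T.powerset
    (fun A => (if A = ∅ then a' else 1) * α * _) (Finset.empty_mem_powerset T)]
  have e2 : ∑ A ∈ T.powerset.erase ∅, (if A = ∅ then a else 1) * α * X A =
      ∑ A ∈ T.powerset.erase ∅, (if A = ∅ then a' else 1) * α * X A := by
    refine Finset.sum_congr rfl fun A hA => ?_
    rw [if_neg (Finset.mem_erase.1 hA).1, if_neg (Finset.mem_erase.1 hA).1]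
  have e3 : X ∅ = prefixedSum c a' b' α z' q T := by
    simp only [hX, Finset.sdiff_empty]
    rw [← IH T subset_rfl m m le_rfl le_rfl, IH T subset_rfl m z' le_rfl hz'.le]
    simp [arrangementSum, arrangements_empty, wordWeight]
  rw [e2, IH T subset_rfl z z' hz.le hz'.le, ← e3]
  simp only [if_true]
  change b * α * X ∅ + (a * α * X ∅ + _) = b' * α * X ∅ + (a' * α * X ∅ + _)
  linear_combination α * X ∅ * h

end Weights

theorem wB_eq_getD (w : List ℕ) (i : ℕ) :
    wB w i = ((w.length + 1) :: w).getD i (w.length + 1) := by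
  rcases i with _ | i
  · simp [wB]
  · by_cases h : i < w.length
    · simp [wB, h]
    · simp [wB, h]

theorem prod_Icc_one_eq_prod_range {M : Type*} [CommMonoid M] (f : ℕ → M) (n : ℕ) :
    ∏ i ∈ Finset.Icc 1 n, f i = ∏ i ∈ Finset.range n, f (i + 1) := by
  rw [show Finset.Icc 1 n = Finset.Ico 1 (n + 1) by ext; simp; try omega,
    Finset.prod_Ico_eq_prod_range]
  simp [add_comm]

theorem wordWeight_eq_prod {R : Type*} [CommRing R] (c a b : R) (p : ℕ) (l : List ℕ) (q : ℕ) :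
    wordWeight c a b p l q = ∏ i ∈ Finset.range l.length,
      letterWeight c a b ((p :: l).getD i q) ((p :: l).getD (i + 1) q)
        ((p :: l).getD (i + 2) q) := by
  induction l generalizing p with
  | nil => simp [wordWeight]
  | cons x l ih =>
    rw [wordWeight, ih, List.length_cons, Finset.prod_range_succ', mul_comm]
    congr 1
    cases l <;> rfl

theorem pow_statistics_eq_wordWeight {R : Type*} [CommRing R] (c a b : R) (w : List ℕ) :
    c ^ pkW w * a ^ daW w * b ^ ddW w =
      wordWeight c a b (w.length + 1) w (w.length + 1) := by
  rw [wordWeight_eq_prod]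
  simp_rw [← wB_eq_getD]
  refine Eq.trans ?_ (prod_Icc_one_eq_prod_range (fun i => letterWeight c a b (wB w (i - 1)) (wB w i)
    (wB w (i + 1))) w.length)
  simp only [letterWeight, Finset.prod_mul_distrib, ← Finset.prod_filter, Finset.prod_const]
  rfl

theorem countRLMin_eq_sum (l : List ℕ) :
    countRLMin l = ∑ i ∈ Finset.range l.length,
      if ∀ j < l.length, i < j → l.getD i 0 < l.getD j 0 then 1 else 0 := by
  induction l with
  | nil => rfl
  | cons x l ih =>
    rw [countRLMin, ih, List.length_cons, Finset.sum_range_succ', add_comm]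
    congr 1
    · refine Finset.sum_congr rfl fun i _ => if_congr ?_ rfl rfl
      constructor
      · intro h j hj hij
        obtain ⟨j, rfl⟩ : ∃ k, j = k + 1 := ⟨j - 1, by omega⟩
        simpa using h j (by omega) (by omega)
      · intro h j hj hij
        simpa using h (j + 1) (by omega) (by omega)
    · refine if_congr ?_ rfl rfl
      constructor
      · intro h j hj hij
        obtain ⟨j, rfl⟩ : ∃ k, j = k + 1 := ⟨j - 1, by omega⟩
        have hj' : j < l.length := by omega
        simpa [hj'] using h _ (List.getElem_mem hj')
      · intro h y hy
        obtain ⟨j, hj, rfl⟩ := List.mem_iff_getElem.1 hy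
        simpa [hj] using h (j + 1) (by omega) (by omega)

theorem wB_succ {w : List ℕ} {i : ℕ} (h : i < w.length) : wB w (i + 1) = w[i] := by
  simp [wB, h]

theorem rlminW_eq_countRLMin (w : List ℕ) : rlminW w = countRLMin w := by
  rw [countRLMin_eq_sum, rlminW, Finset.card_filter,
    show Finset.Icc 1 w.length = Finset.Ico 1 (w.length + 1) by ext; simp; try omega,
    Finset.sum_Ico_eq_sum_range]
  refine Finset.sum_congr rfl fun i hi => if_congr ?_ rfl rfl
  have hi : i < w.length := by simpa using hi
  rw [add_comm 1 i, isRLat, wB_succ hi]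
  constructor
  · intro h j hj hij
    have := h (j + 1) (Finset.mem_Icc.2 (by omega))
    rw [wB_succ hj] at this
    simpa [hi, hj] using this
  · intro h j hj
    rw [Finset.mem_Icc] at hj
    obtain ⟨j, rfl⟩ : ∃ k, j = k + 1 := ⟨j - 1, by omega⟩
    have hj' : j < w.length := by omega
    rw [wB_succ hj']
    simpa [hi, hj'] using h j hj' (by omega)

section Arrangement

variable {N : ℕ} {l : List ℕ}

theorem length_of_arrangement (h : l ∈ arrangements (Finset.Icc 1 N)) : l.length = N := by
  obtain ⟨h1, h2⟩ := mem_arrangements.1 h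
  rw [← List.toFinset_card_of_nodup h1, h2]
  simp

theorem wB_mem_Icc (h : l ∈ arrangements (Finset.Icc 1 N)) {i : ℕ} (h1 : 1 ≤ i) (h2 : i ≤ N) :
    1 ≤ wB l i ∧ wB l i ≤ N := by
  obtain ⟨j, rfl⟩ : ∃ k, i = k + 1 := ⟨i - 1, by omega⟩
  have hj : j < l.length := by rw [length_of_arrangement h]; omega
  rw [wB_succ hj, ← Finset.mem_Icc, ← mem_of_arrangement h]
  exact List.getElem_mem hj

theorem wB_injOn (h : l ∈ arrangements (Finset.Icc 1 N)) {i j : ℕ} (hi : 1 ≤ i) (hi' : i ≤ N)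
    (hj : 1 ≤ j) (hj' : j ≤ N) (e : wB l i = wB l j) : i = j := by
  obtain ⟨i, rfl⟩ : ∃ k, i = k + 1 := ⟨i - 1, by omega⟩
  obtain ⟨j, rfl⟩ : ∃ k, j = k + 1 := ⟨j - 1, by omega⟩
  have hl := length_of_arrangement h
  rw [wB_succ (by omega), wB_succ (by omega)] at e
  rw [(mem_arrangements.1 h).1.getElem_inj_iff.1 e]

theorem wB_zero : wB l 0 = l.length + 1 := by simp [wB]

theorem wB_length_succ : wB l (l.length + 1) = l.length + 1 := by simp [wB]

theorem desW_eq (h : l ∈ arrangements (Finset.Icc 1 N)) : desW l = pkW l + ddW l := by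
  have hl := length_of_arrangement h
  rw [desW, pkW, ddW, ← Finset.card_union_of_disjoint]
  · congr 1
    ext i
    simp only [Finset.mem_filter, Finset.mem_Icc, Finset.mem_union]
    constructor
    · rintro ⟨⟨h1, h2⟩, h3⟩
      have h4 : wB l (i - 1) ≠ wB l i := by
        intro e
        rcases Nat.lt_or_ge 1 i with h5 | h5
        · have := wB_injOn h (by omega) (by omega) (by omega) (by omega) e
          omega
        · obtain rfl : i = 1 := by omega
          have := wB_mem_Icc h (i := 1) (by omega) (by omega)
          rw [show 1 - 1 = 0 from rfl, wB_zero] at e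
          omega
      rcases lt_or_gt_of_ne h4 with h4 | h4
      · exact Or.inl ⟨by omega, h4, h3⟩
      · exact Or.inr ⟨by omega, h4, h3⟩
    · have key : ∀ i, 1 ≤ i → i ≤ l.length → wB l (i + 1) < wB l i →
          (1 ≤ i ∧ i ≤ l.length - 1) ∧ wB l (i + 1) < wB l i := by
        intro i h1 h2 h3
        refine ⟨⟨h1, ?_⟩, h3⟩
        by_contra h4
        obtain rfl : i = l.length := by omega
        have := wB_mem_Icc h h1 (by omega)
        rw [wB_length_succ] at h3
        omega
      rintro (⟨h1, h2, h3⟩ | ⟨h1, h2, h3⟩) <;> exact key i h1.1 h1.2 h3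
  · rw [Finset.disjoint_filter]
    rintro i _ ⟨h1, _⟩ ⟨h2, _⟩
    omega

theorem ascW_eq (h : l ∈ arrangements (Finset.Icc 1 N)) : ascW l = pkW l + daW l := by
  have hl := length_of_arrangement h
  rw [ascW, pkW, daW, ← Finset.card_union_of_disjoint]
  · refine Finset.card_bij (fun i _ => i + 1) ?_ (by simp) ?_
    · intro i hi
      simp only [Finset.mem_filter, Finset.mem_Icc, Finset.mem_union] at hi ⊢
      obtain ⟨⟨h1, h2⟩, h3⟩ := hi
      have h4 : wB l (i + 1) ≠ wB l (i + 1 + 1) := by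
        intro e
        rcases Nat.lt_or_ge (i + 1) N with h5 | h5
        · have := wB_injOn h (by omega) (by omega) (by omega) (by omega) e
          omega
        · obtain h6 : i + 1 = l.length := by omega
          have := wB_mem_Icc h (i := i + 1) (by omega) (by omega)
          rw [h6, wB_length_succ] at e
          rw [h6] at this
          omega
      rcases lt_or_gt_of_ne h4 with h4 | h4
      · exact Or.inr ⟨by omega, h3, h4⟩
      · exact Or.inl ⟨by omega, h3, h4⟩
    · intro i hi
      have h1 : (1 ≤ i ∧ i ≤ l.length) ∧ wB l (i - 1) < wB l i := by
        simp only [Finset.mem_filter, Finset.mem_Icc, Finset.mem_union] at hi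
        rcases hi with ⟨h1, h2, h3⟩ | ⟨h1, h2, h3⟩ <;> exact ⟨h1, h2⟩
      have h5 : 1 < i := by
        by_contra h2
        obtain rfl : i = 1 := by omega
        have h3 := wB_mem_Icc h (i := 1) (by omega) (by omega)
        have h4 := h1.2
        rw [show 1 - 1 = 0 from rfl, wB_zero] at h4
        omega
      refine ⟨i - 1, ?_, by omega⟩
      simp only [Finset.mem_filter, Finset.mem_Icc]
      rw [show i - 1 + 1 = i by omega]
      exact ⟨by omega, h1.2⟩
  · rw [Finset.disjoint_filter]
    rintro i _ ⟨_, h1⟩ ⟨_, h2⟩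
    omega

end Arrangement

section SplitAtOne

variable {N : ℕ} {v w : List ℕ}

theorem wB_append_left {i : ℕ} (h : i < v.length) : wB (v ++ 1 :: w) (i + 1) = v[i] := by
  rw [wB_succ (by simp; omega), List.getElem_append_left h]

theorem wB_append_one : wB (v ++ 1 :: w) (v.length + 1) = 1 := by
  rw [wB_succ (by simp)]
  simp

theorem isPRW_append_cons_iff (h : v ++ 1 :: w ∈ arrangements (Finset.Icc 1 N)) :
    isPRW (v ++ 1 :: w) ↔ v.Pairwise (· > ·) := by
  have hl := length_of_arrangement h
  have hlen : v.length + 1 + w.length = N := by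
    rw [← hl]; simp; omega
  have gt_one : ∀ i, 1 ≤ i → i ≤ N → i ≠ v.length + 1 → 1 < wB (v ++ 1 :: w) i := by
    intro i h1 h2 h3
    refine lt_of_le_of_ne (wB_mem_Icc h h1 h2).1 fun e => h3 ?_
    refine wB_injOn h h1 h2 (by omega) (by omega) ?_
    rw [wB_append_one, ← e]
  constructor
  · intro H
    have key : ∀ i, 1 ≤ i → i ≤ v.length →
        ¬ wB (v ++ 1 :: w) i < wB (v ++ 1 :: w) (i + 1) := by
      intro i
      induction i using Nat.strong_induction_on with
      | _ i ih =>
        intro h1 h2 h3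
        have h4 := H i (Finset.mem_Icc.2 (by omega)) h3 fun j hj => by
          rw [Finset.mem_Icc] at hj
          exact ih j (by omega) hj.1 (by omega)
        have := gt_one i h1 (by omega) (by omega)
        omega
    rw [← List.isChain_iff_pairwise, List.isChain_iff_getElem]
    intro i hi
    have h1 := key (i + 1) (by omega) (by omega)
    have h2 : wB (v ++ 1 :: w) (i + 1) ≠ wB (v ++ 1 :: w) (i + 1 + 1) := by
      intro e
      have := wB_injOn h (by omega) (by omega) (by omega) (by omega) e
      omega
    rw [wB_append_left (by omega), wB_append_left hi] at h1 h2
    omega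
  · intro H i hi h1 h2
    rw [Finset.mem_Icc] at hi
    rcases lt_trichotomy i (v.length + 1) with h3 | h3 | h3
    · exfalso
      rcases Nat.lt_or_ge i v.length with h4 | h4
      · obtain ⟨i, rfl⟩ : ∃ k, i = k + 1 := ⟨i - 1, by omega⟩
        rw [wB_append_left (by omega), wB_append_left h4] at h1
        have := List.pairwise_iff_getElem.1 H i (i + 1) (by omega) h4 (by omega)
        omega
      · obtain rfl : i = v.length := by omega
        rw [wB_append_one] at h1
        have := gt_one v.length (by omega) (by omega) (by omega)
        omega
    · rw [h3, wB_append_one]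
    · exfalso
      apply h2 (v.length + 1) (Finset.mem_Icc.2 (by omega))
      rw [wB_append_one]
      exact gt_one _ (by omega) (by omega) (by omega)

theorem lrminW_append_cons (h : v ++ 1 :: w ∈ arrangements (Finset.Icc 1 N))
    (hv : v.Pairwise (· > ·)) : lrminW (v ++ 1 :: w) = v.length + 1 := by
  have hl := length_of_arrangement h
  have hlen : v.length + 1 + w.length = N := by
    rw [← hl]; simp; omega
  rw [lrminW, show (Finset.Icc 1 (v ++ 1 :: w).length).filter (isLRat (v ++ 1 :: w)) =
    Finset.Icc 1 (v.length + 1) from ?_]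
  · simp
  ext i
  simp only [Finset.mem_filter, Finset.mem_Icc, isLRat]
  constructor
  · rintro ⟨h1, h2⟩
    refine ⟨h1.1, ?_⟩
    by_contra h3
    have h4 := h2 (v.length + 1) (by omega)
    rw [wB_append_one] at h4
    have := wB_mem_Icc h h1.1 (by omega)
    omega
  · rintro ⟨h1, h2⟩
    refine ⟨by omega, fun j hj => ?_⟩
    obtain ⟨j, rfl⟩ : ∃ k, j = k + 1 := ⟨j - 1, by omega⟩
    rcases Nat.lt_or_ge v.length i with h3 | h3
    · obtain rfl : i = v.length + 1 := by omega
      refine lt_of_le_of_ne ?_ fun e => ?_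
      · rw [wB_append_one]
        exact (wB_mem_Icc h (by omega) (by omega)).1
      · have := wB_injOn h (by omega) (by omega) (by omega) (by omega) e
        omega
    · obtain ⟨i, rfl⟩ : ∃ k, i = k + 1 := ⟨i - 1, by omega⟩
      rw [wB_append_left (by omega), wB_append_left (by omega)]
      exact List.pairwise_iff_getElem.1 hv j i (by omega) (by omega) (by omega)

theorem wordWeight_of_pairwise_gt {R : Type*} [CommRing R] (c a b : R) {p q : ℕ}
    (hv : v.Pairwise (· > ·)) (hp : ∀ y ∈ v, y < p) (hq : ∀ y ∈ v, q < y) :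
    wordWeight c a b p v q = b ^ v.length := by
  induction v generalizing p with
  | nil => simp [wordWeight]
  | cons x v ih =>
    rw [List.pairwise_cons] at hv
    rw [wordWeight, ih hv.2 hv.1 fun y hy => hq y (by simp [hy]), List.length_cons, pow_succ',
      letterWeight_doubleDescent c a b (hp x (by simp))]
    cases v with
    | nil => exact hq x (by simp)
    | cons y v => exact hv.1 y (by simp)

end SplitAtOne

theorem word_mem_arrangements {N : ℕ} (σ : Equiv.Perm (Fin N)) :
    word σ ∈ arrangements (Finset.Icc 1 N) := by
  rw [mem_arrangements]
  constructor
  · rw [word, List.nodup_ofFn]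
    intro i j h
    exact σ.injective (Fin.ext (by simpa using h))
  · ext y
    simp only [word, List.mem_toFinset, List.mem_ofFn, Finset.mem_Icc]
    constructor
    · rintro ⟨i, rfl⟩
      have := (σ i).isLt
      omega
    · intro hy
      exact ⟨σ.symm ⟨y - 1, by omega⟩, by simp; omega⟩

theorem sum_word_eq_sum_arrangements {M : Type*} [AddCommMonoid M] (N : ℕ) (f : List ℕ → M) :
    ∑ σ : Equiv.Perm (Fin N), f (word σ) = ∑ l ∈ arrangements (Finset.Icc 1 N), f l := by
  have inj : Function.Injective (word : Equiv.Perm (Fin N) → List ℕ) := by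
    intro σ τ h
    ext i
    simpa using congrFun (List.ofFn_injective h) i
  refine Finset.sum_bij (fun σ _ => word σ) ?_ (fun _ _ _ _ h => inj h) ?_ (fun _ _ => rfl)
  · intro σ _
    exact word_mem_arrangements σ
  · intro l hl
    have hlen := length_of_arrangement hl
    have hg : ∀ i : Fin N, 1 ≤ wB l (i + 1) ∧ wB l (i + 1) ≤ N := fun i =>
      wB_mem_Icc hl (by omega) (by omega)
    let g : Fin N → Fin N := fun i => ⟨wB l (i + 1) - 1, by have := hg i; omega⟩
    have hgi : Function.Injective g := by
      intro i j h
      have h1 : wB l (i + 1) - 1 = wB l (j + 1) - 1 := congrArg Fin.val h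
      have := hg i
      have := hg j
      have := wB_injOn hl (by omega) (by omega) (by omega) (by omega)
        (show wB l (i + 1) = wB l (j + 1) by omega)
      exact Fin.ext (by omega)
    refine ⟨Equiv.ofBijective g (Finite.injective_iff_bijective.1 hgi), Finset.mem_univ _, ?_⟩
    refine List.ext_getElem (by simp [word, hlen]) fun i h1 h2 => ?_
    have h3 : i < N := by omega
    have := hg ⟨i, h3⟩
    simp only [word, List.getElem_ofFn, Equiv.ofBijective_apply, g]
    rw [← wB_succ h2]
    simp only at this
    omega

theorem sum_PRW_eq_prefixedSum {R : Type*} [CommRing R] (c a b α : R) {N : ℕ} (hN : 1 ≤ N) :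
    ∑ σ ∈ PRW N, c ^ pkW (word σ) * a ^ daW (word σ) * b ^ ddW (word σ) *
        α ^ (lrminW (word σ) + rlminW (word σ) - 2) =
      prefixedSum c a b α 1 (N + 1) (Finset.Icc 2 N) := by
  have h1 : (1 : ℕ) ∉ Finset.Icc 2 N := by simp
  have hI : insert 1 (Finset.Icc 2 N) = Finset.Icc 1 N := by
    ext; simp; omega
  rw [PRW, Finset.sum_filter, sum_word_eq_sum_arrangements N fun l =>
    if isPRW l then c ^ pkW l * a ^ daW l * b ^ ddW l * α ^ (lrminW l + rlminW l - 2) else 0,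
    ← hI, sum_arrangements_insert h1, prefixedSum]
  refine Finset.sum_congr rfl fun D hD => ?_
  rw [Finset.mem_powerset] at hD
  have hsort : D.sort (· ≥ ·) ∈ arrangements D :=
    mem_arrangements.2 ⟨D.sort_nodup _, D.sort_toFinset _⟩
  have hsorted : (D.sort (· ≥ ·)).Pairwise (· > ·) :=
    (D.sortedGT_sort).pairwise
  have hins : ∀ v ∈ arrangements D, ∀ w ∈ arrangements (Finset.Icc 2 N \ D),
      v ++ 1 :: w ∈ arrangements (Finset.Icc 1 N) := by
    intro v hv w hw
    rw [← hI]
    exact append_cons_mem_arrangements h1 hD hv hw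
  rw [Finset.sum_eq_single_of_mem _ hsort]
  · rw [rlMinSum, Finset.mul_sum]
    refine Finset.sum_congr rfl fun w hw => ?_
    have hl := hins _ hsort w hw
    have hv2 : ∀ y ∈ D.sort (· ≥ ·), 1 < y ∧ y < N + 1 := fun y hy => by
      have := Finset.mem_Icc.1 (hD ((mem_of_arrangement hsort).1 hy))
      omega
    have hw2 : ∀ y ∈ w, 1 < y := fun y hy => by
      have := Finset.mem_Icc.1 (Finset.mem_sdiff.1 ((mem_of_arrangement hw).1 hy)).1
      omega
    rw [if_pos ((isPRW_append_cons_iff hl).2 hsorted), pow_statistics_eq_wordWeight,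
      length_of_arrangement hl, wordWeight_append_cons, lrminW_append_cons hl hsorted,
      rlminW_eq_countRLMin, countRLMin_append_cons (fun y hy => (hv2 y hy).1) hw2,
      wordWeight_of_pairwise_gt c a b hsorted (fun y hy => (hv2 y hy).2)
        (fun y hy => (hv2 y hy).1), letterWeight_valley c a b
        (lt_getLastD (fun y hy => (hv2 y hy).1) fun _ => by omega)
        (lt_headD hw2 fun _ => by omega), Finset.length_sort,
      show D.card + 1 + (1 + countRLMin w) - 2 = D.card + countRLMin w by omega]
    ring
  · intro v hv hne
    refine Finset.sum_eq_zero fun w hw => if_neg fun h => hne ?_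
    rw [isPRW_append_cons_iff (hins v hv w hw)] at h
    refine List.Perm.eq_of_pairwise' h hsorted ?_
    exact List.perm_of_nodup_nodup_toFinset_eq (mem_arrangements.1 hv).1 (D.sort_nodup _)
      ((mem_arrangements.1 hv).2.trans (mem_arrangements.1 hsort).2.symm)

/-- Theorem 1.5 of the paper: for ring elements with
`x + y = u₃ + u₄` and `x·y = u₁·u₂`, the binomial-Stirling-Eulerian polynomial
over `PRW_{n+1}` refines via peaks, double ascents and double descents. -/
theorem binomialStirlingEulerian_refinement {R : Type*} [CommRing R] (n : ℕ) (hn : 1 ≤ n)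
    (x y u₁ u₂ u₃ u₄ α : R) (h₁ : x + y = u₃ + u₄) (h₂ : x * y = u₁ * u₂) :
    ∑ σ ∈ PRW (n + 1), x ^ desW (word σ) * y ^ ascW (word σ) *
        α ^ (lrminW (word σ) + rlminW (word σ) - 2)
      = ∑ σ ∈ PRW (n + 1), (u₁ * u₂) ^ pkW (word σ) * u₃ ^ daW (word σ) *
          u₄ ^ ddW (word σ) * α ^ (lrminW (word σ) + rlminW (word σ) - 2) := by
  have key : ∀ σ ∈ PRW (n + 1), x ^ desW (word σ) * y ^ ascW (word σ) *
        α ^ (lrminW (word σ) + rlminW (word σ) - 2) =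
      (u₁ * u₂) ^ pkW (word σ) * y ^ daW (word σ) *
          x ^ ddW (word σ) * α ^ (lrminW (word σ) + rlminW (word σ) - 2) := by
    intro σ _
    have h := word_mem_arrangements σ
    rw [desW_eq h, ascW_eq h, ← h₂]
    ring
  rw [Finset.sum_congr rfl key, sum_PRW_eq_prefixedSum _ _ _ _ (by omega),
    sum_PRW_eq_prefixedSum _ _ _ _ (by omega)]
  refine prefixedSum_eq _ (by rw [← h₁, add_comm]) α _ _ 1 1 fun z hz => ?_
  rw [Finset.mem_Icc] at hz
  omega
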